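/- Let H ∈ ((Ω(M) ⊗ Ŵ)_{𝕋̂-bas} ⊗ W)^𝕋 be a d-closed flux with ι H = F̂ = dÂ, where A and are connections on the bundles π and π̂ with curvatures F = dA and F̂ = dÂ. Then H = A ∧ F̂ + Ω for some Ω ∈ (Ω(M) ⊗ W ⊗ Ŵ)_{𝕋×𝕋̂-bas}, and the T-dual flux defined by Ĥ = F ∧ Â + Ω satisfies ι̂ Ĥ = F, ι Ĥ = 0, d Ĥ = 0, and Ĥ ∈ ((Ω(M) ⊗ W)_{𝕋-bas} ⊗ Ŵ)^{𝕋̂}. -/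

import Mathlib

/-!
STATEMENT 7: Let `H ∈ ((Ω(M) ⊗ Ŵ)_{𝕋̂-bas} ⊗ W)^𝕋` be a `d`-closed flux with
`ι H = F̂ = dÂ`, where `A` and `Â` are connections on the bundles `π` and `π̂` with
curvatures `F = dA` and `F̂ = dÂ`.  Then `H = A ∧ F̂ + Ω` for some
`Ω ∈ (Ω(M) ⊗ W ⊗ Ŵ)_{𝕋×𝕋̂-bas}`, and the T-dual flux `Ĥ = F ∧ Â + Ω` satisfies
`ι̂ Ĥ = F`, `ι Ĥ = 0`, `d Ĥ = 0` and `Ĥ ∈ ((Ω(M) ⊗ W)_{𝕋-bas} ⊗ Ŵ)^𝕋̂`.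

The Weil model `Ω(M) ⊗ W ⊗ Ŵ` is modeled as an abstract ℝ-algebra with total differential
`d` and total contractions `ι = ι_V + ι_W`, `ι̂ = ι_{V̂} + ι_{Ŵ}`; `L = d∘ι + ι∘d`,
`L̂ = d∘ι̂ + ι̂∘d`.  The Leibniz-rule hypotheses record that `d`, `ι`, `ι̂` are odd
antiderivations and that `A`, `Â` are odd (degree 1).
-/

open LinearMap

variable {Ω : Type} [Ring Ω] [Algebra ℝ Ω]

/-- Lie derivative via Cartan's magic formula. -/
def lieOp (d ι : Ω →ₗ[ℝ] Ω) : Ω →ₗ[ℝ] Ω := d ∘ₗ ι + ι ∘ₗ d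

/-- `((Ω(M) ⊗ Ŵ)_{𝕋̂-bas} ⊗ W)^𝕋`. -/
def hatBasInv (d ι ιhat : Ω →ₗ[ℝ] Ω) : Submodule ℝ Ω :=
  LinearMap.ker ιhat ⊓ LinearMap.ker (lieOp d ιhat) ⊓ LinearMap.ker (lieOp d ι)

/-- `((Ω(M) ⊗ W)_{𝕋-bas} ⊗ Ŵ)^𝕋̂`. -/
def basInv (d ι ιhat : Ω →ₗ[ℝ] Ω) : Submodule ℝ Ω :=
  LinearMap.ker ι ⊓ LinearMap.ker (lieOp d ι) ⊓ LinearMap.ker (lieOp d ιhat)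

/-- `(Ω(M) ⊗ W ⊗ Ŵ)_{𝕋×𝕋̂-bas}`. -/
def fullBas (d ι ιhat : Ω →ₗ[ℝ] Ω) : Submodule ℝ Ω :=
  LinearMap.ker ι ⊓ LinearMap.ker ιhat ⊓
    LinearMap.ker (lieOp d ι) ⊓ LinearMap.ker (lieOp d ιhat)

theorem t_dual_flux_formula
    (d ι ιhat : Ω →ₗ[ℝ] Ω)
    (h_dd : ∀ x, d (d x) = 0) (h_d1 : d (1 : Ω) = 0)
    (A Ahat H : Ω)
    -- `A` is a connection for `π`, `Â` a connection for `π̂`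
    (h_ιA : ι A = 1) (h_Amem : A ∈ hatBasInv d ι ιhat)
    (h_ιhatAhat : ιhat Ahat = 1) (h_Ahatmem : Ahat ∈ basInv d ι ιhat)
    -- `A`, `Â` are odd (degree 1): antiderivation rules for `d`, `ι`, `ι̂` on products
    (h_d_leibA : ∀ x, d (A * x) = d A * x - A * d x)
    (h_ι_leibA : ∀ x, ι (A * x) = ι A * x - A * ι x)
    (h_ιhat_leibA : ∀ x, ιhat (A * x) = ιhat A * x - A * ιhat x)
    (h_d_leibAhat : ∀ x, d (Ahat * x) = d Ahat * x - Ahat * d x)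
    (h_ι_leibAhat : ∀ x, ι (Ahat * x) = ι Ahat * x - Ahat * ι x)
    (h_ιhat_leibAhat : ∀ x, ιhat (Ahat * x) = ιhat Ahat * x - Ahat * ιhat x)
    -- `F = dA`, `F̂ = dÂ` are even (degree 2)
    (h_d_leibF : ∀ x, d (d A * x) = d A * d x)
    (h_ι_leibF : ∀ x, ι (d A * x) = ι (d A) * x + d A * ι x)
    (h_ιhat_leibF : ∀ x, ιhat (d A * x) = ιhat (d A) * x + d A * ιhat x)
    -- the flux: `H ∈ ((Ω(M) ⊗ Ŵ)_{𝕋̂-bas} ⊗ W)^𝕋`, `dH = 0`, `ι H = F̂ = dÂ`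
    (h_Hmem : H ∈ hatBasInv d ι ιhat)
    (h_dH : d H = 0)
    (h_ιH : ι H = d Ahat) :
    -- `H = A ∧ F̂ + Ω` with `Ω` basic, and `Ĥ := F ∧ Â + Ω` is the T-dual flux
    ∃ Ω₀ : Ω, Ω₀ ∈ fullBas d ι ιhat ∧
      H = A * d Ahat + Ω₀ ∧
      ιhat (d A * Ahat + Ω₀) = d A ∧
      ι (d A * Ahat + Ω₀) = 0 ∧
      d (d A * Ahat + Ω₀) = 0 ∧
      (d A * Ahat + Ω₀) ∈ basInv d ι ιhat := by
  simp only [hatBasInv, basInv, fullBas, lieOp, Submodule.mem_inf, LinearMap.mem_ker,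
    LinearMap.add_apply, LinearMap.comp_apply] at h_Amem h_Ahatmem h_Hmem ⊢
  obtain ⟨⟨h_ιhatA, h_LhatA⟩, h_LA⟩ := h_Amem
  obtain ⟨⟨h_ιAhat, h_LAhat⟩, h_LhatAhat⟩ := h_Ahatmem
  obtain ⟨⟨h_ιhatH, -⟩, -⟩ := h_Hmem
  -- both curvatures are annihilated by both contractions
  have h_ιhatF : ιhat (d A) = 0 := by simpa [h_ιhatA] using h_LhatA
  have h_ιF : ι (d A) = 0 := by simpa [h_ιA, h_d1] using h_LA
  have h_ιFhat : ι (d Ahat) = 0 := by simpa [h_ιAhat] using h_LAhat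
  have h_ιhatFhat : ιhat (d Ahat) = 0 := by simpa [h_ιhatAhat, h_d1] using h_LhatAhat
  have h_ι : ι (H - A * d Ahat) = 0 := by
    rw [map_sub, h_ιH, h_ι_leibA, h_ιA, h_ιFhat]; simp
  have h_ιhat : ιhat (H - A * d Ahat) = 0 := by
    rw [map_sub, h_ιhatH, h_ιhat_leibA, h_ιhatA, h_ιhatFhat]; simp
  have h_d : d (H - A * d Ahat) = -(d A * d Ahat) := by
    rw [map_sub, h_dH, h_d_leibA, h_dd]; simp
  have h_ιdual : ι (d A * Ahat + (H - A * d Ahat)) = 0 := by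
    rw [map_add, h_ι, h_ι_leibF, h_ιF, h_ιAhat]; simp
  have h_ιhatdual : ιhat (d A * Ahat + (H - A * d Ahat)) = d A := by
    rw [map_add, h_ιhat, h_ιhat_leibF, h_ιhatF, h_ιhatAhat]; simp
  have h_ddual : d (d A * Ahat + (H - A * d Ahat)) = 0 := by
    rw [map_add, h_d, h_d_leibF]; simp
  refine ⟨H - A * d Ahat, ⟨⟨⟨h_ι, h_ιhat⟩, ?_⟩, ?_⟩, by abel, h_ιhatdual, h_ιdual, h_ddual,
    ⟨h_ιdual, ?_⟩, ?_⟩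
  · rw [h_ι, h_d, map_neg, h_ι_leibF, h_ιF, h_ιFhat]; simp
  · rw [h_ιhat, h_d, map_neg, h_ιhat_leibF, h_ιhatF, h_ιhatFhat]; simp
  · rw [h_ιdual, h_ddual]; simp
  · rw [h_ιhatdual, h_ddual, h_dd]; simp
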